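/- arXiv:2103.07967 — 3 statements merged into one kernel-verified Lean document; each statement's English description precedes it below -/
import Mathlib

section
/- Let a ≥ 2 be an integer. Then log lcm(a−1, a²−1, …, aⁿ−1) ∼ (3 log a / π²) · n² as n → ∞. -/
open Filter

lemma aux_moebius_hasSum :
    HasSum (fun k : ℕ => (ArithmeticFunction.moebius k : ℝ) * (1 / (k:ℝ)) ^ 2) (6 / Real.pi ^ 2) := by
  have hs : (1:ℝ) < (2:ℂ).re := by norm_num
  have h1 := (ArithmeticFunction.LSeriesSummable_moebius_iff.mpr hs).LSeriesHasSum
  have h2 := LSeries_one_mul_Lseries_moebius hs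
  rw [LSeries_one_eq_riemannZeta hs, riemannZeta_two] at h2
  have hpi : (Real.pi : ℂ) ≠ 0 := by exact_mod_cast Real.pi_ne_zero
  have h3 : LSeries (fun n => ((ArithmeticFunction.moebius n : ℤ) : ℂ)) 2 = ((6 / Real.pi ^ 2 : ℝ) : ℂ) := by
    push_cast
    field_simp
    field_simp at h2
    linear_combination h2
  rw [h3] at h1
  rw [← Complex.hasSum_ofReal]
  unfold LSeriesHasSum at h1
  convert h1 using 1
  funext k
  rcases Nat.eq_zero_or_pos k with rfl | hk
  · simp
  · rw [LSeries.term_of_ne_zero hk.ne']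
    push_cast
    have : ((k:ℂ)) ^ (2:ℂ) = (k:ℂ)^2 := by
      exact_mod_cast Complex.cpow_natCast (k:ℂ) 2
    rw [this]
    field_simp

lemma aux_sum_moebius (g F : ℕ → ℝ) (h : ∀ n > 0, ∑ i ∈ n.divisors, F i = g n) (N : ℕ) :
    ∑ d ∈ Finset.Ioc 0 N, F d = ∑ k ∈ Finset.Ioc 0 N,
      (ArithmeticFunction.moebius k : ℝ) * ∑ m ∈ Finset.Ioc 0 (N / k), g m := by
  rw [ArithmeticFunction.sum_eq_iff_sum_mul_moebius_eq] at h
  let g' : ArithmeticFunction ℝ := ⟨fun n => if n = 0 then 0 else g n, by simp⟩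
  have h' := ArithmeticFunction.sum_Ioc_mul_eq_sum_sum
    ((ArithmeticFunction.moebius : ArithmeticFunction ℤ) : ArithmeticFunction ℝ) g' N
  have hg : ∀ n, 0 < n → g' n = g n := by
    intro n hn
    show (if n = 0 then 0 else g n) = g n
    rw [if_neg hn.ne']
  refine Eq.trans ?_ (h'.trans ?_)
  · refine Finset.sum_congr rfl fun d hd => ?_
    rw [← h d (Finset.mem_Ioc.mp hd).1, ArithmeticFunction.mul_apply]
    refine Finset.sum_congr rfl fun x hx => ?_
    rw [hg _ (Nat.pos_of_ne_zero (Nat.right_ne_zero_of_mem_divisorsAntidiagonal hx))]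
    simp
  · refine Finset.sum_congr rfl fun d hd => ?_
    simp only [ArithmeticFunction.intCoe_apply]
    congr 1
    exact Finset.sum_congr rfl fun m hm => hg m (Finset.mem_Ioc.mp hm).1

lemma aux_tendsto_div (k : ℕ) : Tendsto (fun n : ℕ => ((n / k : ℕ) : ℝ) / n) atTop (nhds (1 / (k:ℝ))) := by
  have h := (tendsto_nat_floor_mul_div_atTop (R := ℝ) (a := 1 / (k:ℝ)) (by positivity)).comp
    (tendsto_natCast_atTop_atTop (R := ℝ))
  refine h.congr fun n => ?_
  simp only [Function.comp]
  rw [one_div_mul_eq_div, Nat.floor_div_eq_div]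

lemma aux_sum_tendsto (g F : ℕ → ℝ) (h : ∀ n > 0, ∑ i ∈ n.divisors, F i = g n) (C c : ℝ)
    (hC : ∀ m : ℕ, |∑ i ∈ Finset.Ioc 0 m, g i| ≤ C * (m:ℝ)^2)
    (hc : Tendsto (fun m : ℕ => (∑ i ∈ Finset.Ioc 0 m, g i) / (m:ℝ)^2) atTop (nhds c)) :
    Tendsto (fun n : ℕ => (∑ i ∈ Finset.Ioc 0 n, F i) / (n:ℝ)^2) atTop (nhds (c * (6 / Real.pi ^ 2))) := by
  set G : ℕ → ℝ := fun m => ∑ i ∈ Finset.Ioc 0 m, g i with hG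
  have hC0 : 0 ≤ C := by
    have := hC 1
    have h2 := abs_nonneg (∑ i ∈ Finset.Ioc 0 1, g i)
    have h3 := h2.trans this
    norm_num at h3
    exact h3
  have key : ∀ n : ℕ, (∑ i ∈ Finset.Ioc 0 n, F i) / (n:ℝ)^2 =
      ∑' k : ℕ, (ArithmeticFunction.moebius k : ℝ) * (G (n / k) / (n:ℝ)^2) := by
    intro n
    rw [tsum_eq_sum (s := Finset.Ioc 0 n), aux_sum_moebius g F h, Finset.sum_div]
    · exact Finset.sum_congr rfl fun k _ => by rw [mul_div_assoc]
    · intro k hk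
      rcases Nat.eq_zero_or_pos k with rfl | hk0
      · simp
      · have : n / k = 0 := Nat.div_eq_of_lt (by
          by_contra hh
          exact hk (Finset.mem_Ioc.mpr ⟨hk0, by omega⟩))
        simp [this, hG]
  simp_rw [key]
  have hlim : c * (6 / Real.pi ^ 2) =
      ∑' k : ℕ, (ArithmeticFunction.moebius k : ℝ) * (c * (1 / (k:ℝ)) ^ 2) := by
    rw [← aux_moebius_hasSum.tsum_eq, ← tsum_mul_left]
    exact tsum_congr fun k => by ring
  rw [hlim]
  refine tendsto_tsum_of_dominated_convergence (bound := fun k : ℕ => C * (1 / (k:ℝ)^2)) ?_ ?_ ?_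
  · exact (Real.summable_one_div_nat_pow.mpr (by norm_num)).mul_left C
  · intro k
    refine Tendsto.const_mul _ ?_
    rcases Nat.eq_zero_or_pos k with rfl | hk0
    · simp [hG]
    have h1 : Tendsto (fun n : ℕ => n / k) atTop atTop :=
      Nat.tendsto_div_const_atTop hk0.ne'
    have h2 := (hc.comp h1).mul ((aux_tendsto_div k).pow 2)
    refine h2.congr fun n => ?_
    simp only [Function.comp]
    rcases Nat.eq_zero_or_pos (n / k) with h0 | h0
    · simp [h0, hG]
    · have : (((n / k : ℕ)) : ℝ) ≠ 0 := by exact_mod_cast h0.ne'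
      field_simp
      rfl
  · refine Eventually.of_forall fun n k => ?_
    rw [norm_mul]
    have hm : ‖(ArithmeticFunction.moebius k : ℝ)‖ ≤ 1 := by
      rw [Real.norm_eq_abs]
      exact_mod_cast ArithmeticFunction.abs_moebius_le_one
    have hb : ‖G (n / k) / (n:ℝ)^2‖ ≤ C * (1 / (k:ℝ)^2) := by
      rw [norm_div, Real.norm_eq_abs, Real.norm_eq_abs, abs_of_nonneg (by positivity : (0:ℝ) ≤ (n:ℝ)^2)]
      rcases Nat.eq_zero_or_pos n with rfl | hn
      · simp; positivity
      have hn' : (0:ℝ) < n := by exact_mod_cast hn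
      rw [div_le_iff₀ (by positivity)]
      refine (hC _).trans ?_
      have : ((n / k : ℕ) : ℝ) ≤ n / k := Nat.cast_div_le
      calc C * ((n / k : ℕ) : ℝ)^2 ≤ C * ((n:ℝ) / k)^2 := by gcongr
        _ = _ := by ring
    calc _ ≤ 1 * (C * (1 / (k:ℝ)^2)) := by gcongr
      _ = _ := one_mul _

lemma aux_g (a : ℕ) (ha : 2 ≤ a) (m : ℕ) (hm : 0 < m) :
    m * Real.log a - Real.log 2 ≤ Real.log ((a ^ m - 1 : ℕ) : ℝ) ∧
    Real.log ((a ^ m - 1 : ℕ) : ℝ) ≤ m * Real.log a := by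
  have h2 : 2 ≤ a ^ m := ha.trans (Nat.le_self_pow hm.ne' a)
  have hpos : (0:ℝ) < ((a ^ m - 1 : ℕ) : ℝ) := by exact_mod_cast (by omega : 0 < a ^ m - 1)
  have ha0 : (0:ℝ) < a := by exact_mod_cast (by omega : 0 < a)
  constructor
  · rw [sub_le_iff_le_add, ← Real.log_pow, ← Real.log_mul hpos.ne' (by norm_num)]
    apply Real.log_le_log (by positivity)
    exact_mod_cast (by omega : a ^ m ≤ (a ^ m - 1) * 2)
  · rw [← Real.log_pow]
    apply Real.log_le_log hpos
    exact_mod_cast (by omega : (a ^ m - 1) ≤ a ^ m)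

lemma aux_G (a : ℕ) (ha : 2 ≤ a) (m : ℕ) :
    (m * (m + 1) / 2) * Real.log a - m * Real.log 2 ≤ ∑ i ∈ Finset.Ioc 0 m, Real.log ((a ^ i - 1 : ℕ) : ℝ) ∧
    ∑ i ∈ Finset.Ioc 0 m, Real.log ((a ^ i - 1 : ℕ) : ℝ) ≤ (m * (m + 1) / 2) * Real.log a := by
  induction m with
  | zero => simp
  | succ m ih =>
    rw [Finset.sum_Ioc_succ_top (Nat.zero_le m)]
    have := aux_g a ha (m+1) (by omega)
    push_cast at *
    constructor <;> linarith [this.1, this.2, ih.1, ih.2]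

lemma aux_main (a : ℕ) (ha : 2 ≤ a) (F : ℕ → ℝ)
    (h : ∀ n > 0, ∑ i ∈ n.divisors, F i = Real.log ((a ^ n - 1 : ℕ) : ℝ)) :
    Tendsto (fun n : ℕ => (∑ i ∈ Finset.Ioc 0 n, F i) / (n:ℝ)^2) atTop
      (nhds (3 * Real.log a / Real.pi ^ 2)) := by
  have hla : 0 ≤ Real.log a := Real.log_natCast_nonneg a
  have e : 3 * Real.log a / Real.pi ^ 2 = Real.log a / 2 * (6 / Real.pi ^ 2) := by ring
  rw [e]
  refine aux_sum_tendsto (fun n => Real.log ((a ^ n - 1 : ℕ) : ℝ)) F h (Real.log a) _ ?_ ?_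
  · intro m
    rw [abs_of_nonneg]
    · refine (aux_G a ha m).2.trans ?_
      rcases Nat.eq_zero_or_pos m with rfl | hm
      · simp
      have : (1:ℝ) ≤ m := by exact_mod_cast hm
      rw [mul_comm]
      gcongr
      nlinarith
    · exact Finset.sum_nonneg fun i _ => Real.log_natCast_nonneg _
  · have hinv : Tendsto (fun m : ℕ => (1:ℝ) / m) atTop (nhds 0) := tendsto_one_div_atTop_nhds_zero_nat
    have lo : Tendsto (fun m : ℕ => (1 + 1 / (m:ℝ)) / 2 * Real.log a - (1 / (m:ℝ)) * Real.log 2) atTop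
        (nhds (Real.log a / 2)) := by
      have := (((hinv.const_add 1).div_const 2).mul_const (Real.log a)).sub (hinv.mul_const (Real.log 2))
      convert this using 2
      ring
    have hi : Tendsto (fun m : ℕ => (1 + 1 / (m:ℝ)) / 2 * Real.log a) atTop
        (nhds (Real.log a / 2)) := by
      have := (((hinv.const_add 1).div_const 2).mul_const (Real.log a))
      convert this using 2
      ring
    refine tendsto_of_tendsto_of_tendsto_of_le_of_le' lo hi ?_ ?_
    · filter_upwards [eventually_gt_atTop 0] with m hm
      have hm' : (0:ℝ) < m := by exact_mod_cast hm
      rw [le_div_iff₀ (by positivity)]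
      refine le_trans (le_of_eq ?_) (aux_G a ha m).1
      field_simp
    · filter_upwards [eventually_gt_atTop 0] with m hm
      have hm' : (0:ℝ) < m := by exact_mod_cast hm
      rw [div_le_iff₀ (by positivity)]
      refine le_trans (aux_G a ha m).2 (le_of_eq ?_)
      field_simp

noncomputable def cycVal (a d : ℕ) : ℕ := ((Polynomial.cyclotomic d ℤ).eval (a : ℤ)).natAbs

lemma cycVal_cast (a : ℕ) (ha : 2 ≤ a) (d : ℕ) :
    (cycVal a d : ℤ) = (Polynomial.cyclotomic d ℤ).eval (a : ℤ) := by
  unfold cycVal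
  rw [Int.natCast_natAbs, abs_of_pos]
  exact Polynomial.cyclotomic_pos' d (by exact_mod_cast (by omega : 1 < a))

lemma cycVal_pos (a : ℕ) (ha : 2 ≤ a) (d : ℕ) : 0 < cycVal a d := by
  have : (0:ℤ) < cycVal a d := by
    rw [cycVal_cast a ha]
    exact Polynomial.cyclotomic_pos' d (by exact_mod_cast (by omega : 1 < a))
  exact_mod_cast this

lemma cycVal_prod (a : ℕ) (ha : 2 ≤ a) (m : ℕ) (hm : 0 < m) :
    ∏ d ∈ m.divisors, cycVal a d = a ^ m - 1 := by
  have h1 : 1 ≤ a ^ m := Nat.one_le_pow _ _ (by omega)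
  have := congrArg (Polynomial.eval (a:ℤ)) (Polynomial.prod_cyclotomic_eq_X_pow_sub_one hm ℤ)
  rw [Polynomial.eval_prod] at this
  simp only [Polynomial.eval_sub, Polynomial.eval_pow, Polynomial.eval_X, Polynomial.eval_one] at this
  zify [h1]
  rw [← this]
  exact Finset.prod_congr rfl fun d _ => cycVal_cast a ha d

lemma cycVal_dvd (a : ℕ) (ha : 2 ≤ a) (m : ℕ) (hm : 0 < m) : cycVal a m ∣ a ^ m - 1 := by
  rw [← cycVal_prod a ha m hm]
  exact Finset.dvd_prod_of_mem _ (Nat.mem_divisors_self m hm.ne')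

lemma cycVal_prim (a : ℕ) (ha : 2 ≤ a) (d p : ℕ) (hp : p.Prime) (h : p ∣ cycVal a d) (hd : ¬ p ∣ d) :
    IsPrimitiveRoot (a : ZMod p) d := by
  have : Fact p.Prime := ⟨hp⟩
  have : NeZero (d : ZMod p) := ⟨by rwa [Ne, ZMod.natCast_eq_zero_iff]⟩
  rw [← Polynomial.isRoot_cyclotomic_iff, Polynomial.IsRoot.def]
  have h2 := Polynomial.cyclotomic.eval_apply (a:ℤ) d (Int.castRingHom (ZMod p))
  simp only [eq_intCast, Int.cast_natCast] at h2
  rw [h2, ← cycVal_cast a ha, Int.cast_natCast, ZMod.natCast_eq_zero_iff]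
  exact h

lemma cycVal_geom (a : ℕ) (ha : 2 ≤ a) (e k : ℕ) (he : 0 < e) (hk : 2 ≤ k) :
    (cycVal a (e * k) : ℤ) ∣ ∑ i ∈ Finset.range k, ((a:ℤ) ^ e) ^ i := by
  have h := Polynomial.X_pow_sub_one_mul_cyclotomic_dvd_X_pow_sub_one_of_dvd ℤ (d := e) (n := e * k)
    (Nat.mem_properDivisors.mpr ⟨dvd_mul_right _ _, by nlinarith⟩)
  have h := Polynomial.eval_dvd (x := (a:ℤ)) h
  simp only [Polynomial.eval_mul, Polynomial.eval_sub, Polynomial.eval_pow, Polynomial.eval_X,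
    Polynomial.eval_one] at h
  rw [← cycVal_cast a ha, pow_mul, ← mul_geom_sum ((a:ℤ) ^ e) k] at h
  refine (mul_dvd_mul_iff_left ?_).mp h
  have : (1:ℤ) < (a:ℤ) ^ e := one_lt_pow₀ (by exact_mod_cast (by omega : 1 < a)) he.ne'
  omega

lemma cycVal_sq (a : ℕ) (ha : 2 ≤ a) (d p : ℕ) (hd : 3 ≤ d) (hp : p.Prime) (h : p ∣ d) :
    ¬ p ^ 2 ∣ cycVal a d := by
  intro hsq
  have hsq' : (p:ℤ) ^ 2 ∣ (cycVal a d : ℤ) := by exact_mod_cast hsq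
  obtain ⟨e, rfl⟩ := h
  have he : 0 < e := by
    rcases Nat.eq_zero_or_pos e with rfl | h
    · simp at hd
    · exact h
  have hg : (p:ℤ) ^ 2 ∣ ∑ i ∈ Finset.range p, ((a:ℤ) ^ e) ^ i := by
    have := cycVal_geom a ha e p he hp.two_le
    rw [mul_comm e p] at this
    exact hsq'.trans this
  rcases hp.eq_two_or_odd' with rfl | hodd
  · norm_num [Finset.sum_range_succ] at hg
    have hao : Odd (a:ℤ) := by
      by_contra hcon
      rw [Int.not_odd_iff_even] at hcon
      have : Even ((a:ℤ) ^ e) := hcon.pow_of_ne_zero he.ne'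
      obtain ⟨r, hr⟩ := this
      omega
    rcases Nat.even_or_odd e with hev | hodd
    · obtain ⟨s, rfl⟩ := hev
      have := Int.sq_mod_four_eq_one_of_odd (hao.pow (n := s))
      rw [← pow_mul, mul_two] at this
      omega
    · have h2 := hsq'.trans (cycVal_geom a ha 2 e (by norm_num) (by omega))
      have h3 : Odd (∑ i ∈ Finset.range e, ((a:ℤ) ^ 2) ^ i) := by
        have h4 : ∀ k : ℕ, (∑ i ∈ Finset.range k, ((a:ℤ) ^ 2) ^ i) % 2 = (k:ℤ) % 2 := by
          intro k
          induction k with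
          | zero => simp
          | succ k ih =>
            rw [Finset.sum_range_succ]
            obtain ⟨r, hr⟩ := (hao.pow (n := 2)).pow (n := k)
            push_cast
            omega
        rw [Int.odd_iff, h4 e]
        obtain ⟨r, hr⟩ := hodd
        omega
      obtain ⟨r, hr⟩ := h3
      norm_num at h2
      omega
  · have : Fact p.Prime := ⟨hp⟩
    have h1 : (p:ℤ) ∣ (a:ℤ) ^ e - 1 := by
      have h2 : p ∣ a ^ (p * e) - 1 := ((dvd_pow_self p two_ne_zero).trans hsq).trans
        (cycVal_dvd a ha _ (by omega))
      have h1 : 1 ≤ a ^ (p * e) := Nat.one_le_pow _ _ (by omega)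
      have h2' : (p:ℤ) ∣ (a:ℤ) ^ (p * e) - 1 := by
        have : ((p:ℕ):ℤ) ∣ ((a ^ (p * e) - 1 : ℕ) : ℤ) := by exact_mod_cast h2
        push_cast [h1] at this
        exact this
      rw [← ZMod.intCast_zmod_eq_zero_iff_dvd] at h2' ⊢
      push_cast at h2' ⊢
      rwa [mul_comm, pow_mul, ZMod.pow_card] at h2'
    obtain ⟨t, ht⟩ := h1
    have h4 := odd_sq_dvd_geom_sum₂_sub (R := ℤ) (a := 1) t hodd
    have h5 : (a:ℤ) ^ e = 1 + p * t := by linarith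
    simp only [one_pow, mul_one] at h4
    rw [h5] at hg
    have h6 := (dvd_sub_right hg).mp h4
    have h7 : p ^ 2 ∣ p := by exact_mod_cast h6
    have := Nat.le_of_dvd hp.pos h7
    nlinarith [hp.two_le]

lemma lcm_dvd_prod (a : ℕ) (ha : 2 ≤ a) (n : ℕ) :
    Finset.lcm (Finset.Icc 1 n) (fun k => a ^ k - 1) ∣ ∏ d ∈ Finset.Ioc 0 n, cycVal a d := by
  refine Finset.lcm_dvd fun k hk => ?_
  rw [Finset.mem_Icc] at hk
  rw [← cycVal_prod a ha k hk.1]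
  refine Finset.prod_dvd_prod_of_subset _ _ _ fun d hd => ?_
  exact Finset.mem_Ioc.mpr ⟨Nat.pos_of_mem_divisors hd, (Nat.divisor_le hd).trans hk.2⟩

noncomputable def cycPart (a d : ℕ) : ℕ := cycVal a d / (cycVal a d).gcd d

lemma cycPart_mul (a d : ℕ) : (cycVal a d).gcd d * cycPart a d = cycVal a d :=
  Nat.mul_div_cancel' (Nat.gcd_dvd_left _ _)

lemma cycPart_not_dvd (a : ℕ) (ha : 2 ≤ a) (d p : ℕ) (hd : 3 ≤ d) (hp : p.Prime)
    (h : p ∣ cycPart a d) : ¬ p ∣ d := by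
  intro hpd
  have h1 : p ∣ cycVal a d := h.trans ⟨_, by rw [mul_comm, cycPart_mul]⟩
  apply cycVal_sq a ha d p hd hp hpd
  rw [← cycPart_mul a d, pow_two]
  exact mul_dvd_mul (Nat.dvd_gcd h1 hpd) h

lemma prod_dvd_lcm (a : ℕ) (ha : 2 ≤ a) (n : ℕ) :
    ∏ d ∈ Finset.Ioc 2 n, cycPart a d ∣ Finset.lcm (Finset.Icc 1 n) (fun k => a ^ k - 1) := by
  refine Finset.prod_dvd_of_isRelPrime ?_ ?_
  · intro i hi j hj hij
    simp only [Finset.coe_Ioc, Set.mem_Ioc] at hi hj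
    show IsRelPrime (cycPart a i) (cycPart a j)
    rw [← Nat.coprime_iff_isRelPrime]
    refine Nat.coprime_of_dvd fun p hp h1 h2 => hij ?_
    have key : ∀ d, 2 < d → p ∣ cycPart a d → IsPrimitiveRoot (a : ZMod p) d := fun d hd h =>
      cycVal_prim a ha d p hp (h.trans ⟨_, by rw [mul_comm, cycPart_mul]⟩)
        (cycPart_not_dvd a ha d p hd hp h)
    exact (key i hi.1 h1).unique (key j hj.1 h2)
  · intro d hd
    rw [Finset.mem_Ioc] at hd
    have h1 : cycPart a d ∣ cycVal a d := ⟨_, by rw [mul_comm, cycPart_mul]⟩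
    exact (h1.trans (cycVal_dvd a ha d (by omega))).trans
      (Finset.dvd_lcm (f := fun k => a ^ k - 1) (Finset.mem_Icc.mpr ⟨by omega, hd.2⟩))

lemma log_upper (a : ℕ) (ha : 2 ≤ a) (n : ℕ) :
    Real.log (Finset.lcm (Finset.Icc 1 n) (fun k => a ^ k - 1) : ℕ) ≤
      ∑ d ∈ Finset.Ioc 0 n, Real.log (cycVal a d) := by
  have hpos : ∀ d, 0 < cycVal a d := cycVal_pos a ha
  have hP : 0 < ∏ d ∈ Finset.Ioc 0 n, cycVal a d := Finset.prod_pos fun d _ => hpos d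
  rw [← Real.log_prod (fun d _ => by exact_mod_cast (hpos d).ne'), ← Nat.cast_prod]
  apply Real.log_le_log
  · exact_mod_cast Nat.pos_of_dvd_of_pos (lcm_dvd_prod a ha n) hP
  · exact_mod_cast Nat.le_of_dvd hP (lcm_dvd_prod a ha n)

lemma log_lower (a : ℕ) (ha : 2 ≤ a) (n : ℕ) (hn : 2 ≤ n) :
    ∑ d ∈ Finset.Ioc 0 n, Real.log (cycVal a d) - ∑ d ∈ Finset.Ioc 0 2, Real.log (cycVal a d)
      - n * Real.log n ≤
    Real.log (Finset.lcm (Finset.Icc 1 n) (fun k => a ^ k - 1) : ℕ) := by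
  have hpos : ∀ d, 0 < cycVal a d := cycVal_pos a ha
  have hposP : ∀ d, 0 < cycPart a d := fun d => by
    rcases Nat.eq_zero_or_pos (cycPart a d) with h | h
    · have := cycPart_mul a d
      rw [h, mul_zero] at this
      have := hpos d
      omega
    · exact h
  have hL : 0 < Finset.lcm (Finset.Icc 1 n) (fun k => a ^ k - 1) :=
    Nat.pos_of_dvd_of_pos (lcm_dvd_prod a ha n) (Finset.prod_pos fun d _ => hpos d)
  have h1 : ∑ d ∈ Finset.Ioc 2 n, Real.log (cycPart a d) ≤
      Real.log (Finset.lcm (Finset.Icc 1 n) (fun k => a ^ k - 1) : ℕ) := by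
    rw [← Real.log_prod (fun d _ => by exact_mod_cast (hposP d).ne'), ← Nat.cast_prod]
    apply Real.log_le_log
    · exact_mod_cast Finset.prod_pos fun d _ => hposP d
    · exact_mod_cast Nat.le_of_dvd hL (prod_dvd_lcm a ha n)
  have h2 : ∑ d ∈ Finset.Ioc 2 n, Real.log (cycVal a d) ≤
      ∑ d ∈ Finset.Ioc 2 n, (Real.log (cycPart a d) + Real.log n) := by
    refine Finset.sum_le_sum fun d hd => ?_
    rw [Finset.mem_Ioc] at hd
    rw [← Real.log_mul (by exact_mod_cast (hposP d).ne') (by norm_cast; omega)]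
    apply Real.log_le_log (by exact_mod_cast hpos d)
    have h3 : cycVal a d ≤ cycPart a d * n := by
      conv_lhs => rw [← cycPart_mul a d, mul_comm]
      exact Nat.mul_le_mul_left _ ((Nat.gcd_le_right _ (by omega)).trans hd.2)
    exact_mod_cast h3
  rw [Finset.sum_add_distrib, Finset.sum_const, nsmul_eq_mul, Nat.card_Ioc] at h2
  have h4 : ((n - 2 : ℕ) : ℝ) * Real.log n ≤ n * Real.log n := by
    have := Real.log_natCast_nonneg n
    gcongr
    omega
  have h5 := Finset.sum_Ioc_consecutive (fun d => Real.log (cycVal a d)) (Nat.zero_le 2) hn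
  linarith

theorem stmt_13 (a : ℕ) (ha : 2 ≤ a) :
    Tendsto (fun n : ℕ =>
        Real.log (Finset.lcm (Finset.Icc 1 n) (fun k => a ^ k - 1) : ℕ) /
          ((3 * Real.log a / Real.pi ^ 2) * (n : ℝ) ^ 2))
      atTop (nhds 1) := by
  have hS := aux_main a ha (fun d => Real.log (cycVal a d)) (by
    intro n hn
    rw [← cycVal_prod a ha n hn, Nat.cast_prod,
      Real.log_prod (fun d _ => by exact_mod_cast (cycVal_pos a ha d).ne')])
  have hla : 0 < Real.log a := Real.log_pos (by exact_mod_cast (by omega : 1 < a))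
  have hK : 3 * Real.log a / Real.pi ^ 2 ≠ 0 := by positivity
  set K := 3 * Real.log a / Real.pi ^ 2 with hKdef
  set B := ∑ d ∈ Finset.Ioc 0 2, Real.log (cycVal a d) with hB
  have hinv : Tendsto (fun m : ℕ => (1:ℝ) / m) atTop (nhds 0) := tendsto_one_div_atTop_nhds_zero_nat
  have hlog : Tendsto (fun n : ℕ => Real.log n / (n:ℝ)) atTop (nhds 0) :=
    (Real.isLittleO_log_id_atTop.tendsto_div_nhds_zero).comp tendsto_natCast_atTop_atTop
  have lo : Tendsto (fun n : ℕ => (∑ d ∈ Finset.Ioc 0 n, Real.log (cycVal a d)) / (n:ℝ)^2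
      - B * (1 / (n:ℝ))^2 - Real.log n / (n:ℝ)) atTop (nhds K) := by
    have := (hS.sub ((hinv.pow 2).const_mul B)).sub hlog
    simpa using this
  have main : Tendsto (fun n : ℕ =>
      Real.log (Finset.lcm (Finset.Icc 1 n) (fun k => a ^ k - 1) : ℕ) / (n:ℝ)^2) atTop (nhds K) := by
    refine tendsto_of_tendsto_of_tendsto_of_le_of_le' lo hS ?_ ?_
    · filter_upwards [eventually_ge_atTop 2] with n hn
      have hn' : (0:ℝ) < n := by exact_mod_cast (by omega : 0 < n)
      rw [le_div_iff₀ (by positivity)]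
      refine le_trans (le_of_eq ?_) (log_lower a ha n hn)
      field_simp
      rfl
    · refine Eventually.of_forall fun n => ?_
      have := log_upper a ha n
      gcongr
  have := main.div_const K
  rw [div_self hK] at this
  refine this.congr fun n => ?_
  rw [div_div, mul_comm K]
end

section
/- Let a ≥ 2 be an integer. Then log lcm(a+1, a²+1, …, aⁿ+1) ∼ (4 log a / π²) · n² as n → ∞. -/
open Filter

namespace LcmAux
open Polynomial

/-- Value of the cyclotomic polynomial. -/
noncomputable def E (a e : ℕ) : ℤ := (cyclotomic e ℤ).eval (a : ℤ)

lemma E_pos (a e : ℕ) (ha : 2 ≤ a) : 0 < E a e :=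
  cyclotomic_pos' e (by exact_mod_cast ha)

lemma E_dvd_geom (a : ℕ) (ha : 2 ≤ a) (g k : ℕ) (hg : 0 < g) (hk : 1 < k) :
    E a (g * k) ∣ ∑ i ∈ Finset.range k, ((a : ℤ) ^ g) ^ i := by
  have h1 : g ∈ (g * k).properDivisors := by
    rw [Nat.mem_properDivisors]
    exact ⟨Dvd.intro _ rfl, by nlinarith⟩
  have h2 := map_dvd (evalRingHom (a : ℤ)) (X_pow_sub_one_mul_cyclotomic_dvd_X_pow_sub_one_of_dvd ℤ h1)
  simp only [map_mul, coe_evalRingHom, eval_sub, eval_pow, eval_X, eval_one] at h2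
  have h3 : (a : ℤ) ^ g - 1 ≠ 0 := by
    have : (1 : ℤ) < (a : ℤ) ^ g := one_lt_pow₀ (by exact_mod_cast ha) hg.ne'
    omega
  rw [pow_mul, ← geom_sum_mul (((a : ℤ)) ^ g), mul_comm] at h2
  exact (mul_dvd_mul_iff_right h3).1 h2

lemma E_dvd_pow (a e : ℕ) : E a e ∣ (a : ℤ) ^ e - 1 := by
  have h2 := map_dvd (evalRingHom (a : ℤ)) (cyclotomic.dvd_X_pow_sub_one e ℤ)
  simpa [E] using h2

lemma zmod_pow_one (a e p : ℕ) (h : (p : ℤ) ∣ E a e) : (a : ZMod p) ^ e = 1 := by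
  have h1 := h.trans (E_dvd_pow a e)
  rw [← ZMod.intCast_zmod_eq_zero_iff_dvd] at h1
  simp at h1
  exact sub_eq_zero.1 h1

lemma geom_zmod (a p g k : ℕ) (h : (a : ZMod p) ^ g = 1)
    (h2 : (p : ℤ) ∣ ∑ i ∈ Finset.range k, ((a : ℤ) ^ g) ^ i) : p ∣ k := by
  rw [← ZMod.intCast_zmod_eq_zero_iff_dvd] at h2
  simp [h] at h2
  exact (ZMod.natCast_eq_zero_iff _ _).1 h2

lemma lemA (a : ℕ) (ha : 2 ≤ a) (p d e : ℕ) (hd : 0 < d) (hde : d < e)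
    (h1 : (p : ℤ) ∣ E a d) (h2 : (p : ℤ) ∣ E a e) : p ∣ e := by
  have h3 := pow_gcd_eq_one.2 ⟨zmod_pow_one _ _ _ h1, zmod_pow_one _ _ _ h2⟩
  obtain ⟨k, hk⟩ := Nat.gcd_dvd_right d e
  have hg : 0 < Nat.gcd d e := Nat.gcd_pos_of_pos_left _ hd
  have hgd : Nat.gcd d e ≤ d := Nat.gcd_le_left _ hd
  have hk1 : 1 < k := by
    by_contra hcon
    have : Nat.gcd d e * k ≤ Nat.gcd d e * 1 := Nat.mul_le_mul_left _ (by omega)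
    omega
  generalize hgg : Nat.gcd d e = g at *
  subst hk
  have := geom_zmod a p g k h3 (h2.trans (E_dvd_geom a ha g k hg hk1))
  exact this.mul_left _

lemma zmod_two_aux : ∀ x : ZMod 2, x ≠ 0 → x = 1 := by decide

lemma lemB (a : ℕ) (ha : 2 ≤ a) (p m : ℕ) (hp : p.Prime) (hm : 1 < m) (hpe : p ∣ 2 * m)
    (h : (p : ℤ) ^ 2 ∣ E a (2 * m)) : False := by
  have := Fact.mk hp
  have h0 : (p : ℤ) ∣ E a (2 * m) := (Dvd.intro_left (p : ℤ) (by ring)).trans h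
  have hz := zmod_pow_one _ _ _ h0
  rcases hp.eq_two_or_odd' with rfl | hodd
  · have ha1 : (a : ZMod 2) = 1 := by
      have : (a : ZMod 2) ≠ 0 := by
        intro h; rw [h, zero_pow (by omega)] at hz; exact absurd hz zero_ne_one
      exact zmod_two_aux _ this
    rcases Nat.even_or_odd m with ⟨k, hk⟩ | hmo
    · have h4 := (mul_comm 2 m ▸ h).trans (E_dvd_geom a ha m 2 (by omega) (by omega))
      have hao : Odd (a : ℤ) := by
        have : Odd a := (ZMod.natCast_eq_one_iff_odd).1 ha1
        exact_mod_cast this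
      obtain ⟨t, ht⟩ := hao.pow (n := k)
      rw [Finset.sum_range_succ, Finset.sum_range_one, hk, ← two_mul, mul_comm 2 k, pow_mul _ k 2, ht] at h4
      ring_nf at h4
      norm_num at h4
    · have := geom_zmod a 2 2 m (by simp [ha1]) (h0.trans (E_dvd_geom a ha 2 m (by omega) hm))
      rw [Nat.odd_iff] at hmo
      omega
  · obtain ⟨g, hg⟩ := hpe
    have hg0 : 0 < g := by
      rcases Nat.eq_zero_or_pos g with rfl | h
      · omega
      · exact h
    rw [mul_comm p g] at hg
    rw [hg] at h hz
    rw [pow_mul, ZMod.pow_card] at hz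
    have hdiv : (p : ℤ) ∣ (a : ℤ) ^ g - 1 := by
      rw [← ZMod.intCast_zmod_eq_zero_iff_dvd]
      simp [hz]
    obtain ⟨t, ht⟩ := hdiv
    have ht' : (a : ℤ) ^ g = 1 + p * t := by linarith
    have h4 := h.trans (E_dvd_geom a ha g p hg0 hp.one_lt)
    have h5 := odd_sq_dvd_geom_sum₂_sub (R := ℤ) (a := 1) t hodd
    simp only [one_pow, mul_one] at h5
    rw [ht'] at h4
    have h6 := (dvd_sub_right h4).1 h5
    have h7 : p ^ 2 ∣ p := by exact_mod_cast h6
    have := Nat.le_of_dvd hp.pos h7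
    nlinarith [hp.one_lt]

/-- The natural number `Φ_{2m}(a)`. -/
noncomputable def Psi (a m : ℕ) : ℕ := (E a (2 * m)).natAbs

lemma Psi_cast (a m : ℕ) (ha : 2 ≤ a) : (Psi a m : ℤ) = E a (2 * m) :=
  Int.natAbs_of_nonneg (E_pos a _ ha).le

lemma Psi_pos (a m : ℕ) (ha : 2 ≤ a) : 0 < Psi a m :=
  Int.natAbs_pos.2 (E_pos a _ ha).ne'

lemma prod_E (a k : ℕ) (hk : 0 < k) : ∏ e ∈ k.divisors, E a e = (a : ℤ) ^ k - 1 := by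
  have := congrArg (eval (a : ℤ)) (prod_cyclotomic_eq_X_pow_sub_one hk ℤ)
  rw [eval_prod] at this
  simpa [E] using this

lemma prod_Psi (a k : ℕ) (ha : 2 ≤ a) (hk : 0 < k) :
    ∏ d ∈ k.divisors with Odd (k / d), Psi a d = a ^ k + 1 := by
  have h1 : (a : ℤ) ^ k - 1 ≠ 0 := by
    have : (1 : ℤ) < (a : ℤ) ^ k := one_lt_pow₀ (by exact_mod_cast ha) hk.ne'
    omega
  have hsub : k.divisors ⊆ (2 * k).divisors := Nat.divisors_subset_of_dvd (by omega) (Dvd.intro_left _ rfl)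
  have h2 := Finset.prod_sdiff (f := E a) hsub
  rw [prod_E a k hk, prod_E a (2 * k) (by omega)] at h2
  have h3 : ∏ e ∈ (2 * k).divisors \ k.divisors, E a e = (a : ℤ) ^ k + 1 := by
    apply mul_right_cancel₀ h1
    rw [h2]; ring
  have h4 : (2 * k).divisors \ k.divisors = (k.divisors.filter (fun d => Odd (k / d))).image (2 * ·) := by
    ext e
    simp only [Finset.mem_sdiff, Nat.mem_divisors, Finset.mem_image, Finset.mem_filter]
    constructor
    · rintro ⟨⟨he, -⟩, hne⟩
      have hne' : ¬ e ∣ k := fun h => hne ⟨h, by omega⟩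
      rcases Nat.even_or_odd' e with ⟨d, rfl | rfl⟩
      · have hd : d ∣ k := (Nat.mul_dvd_mul_iff_left (by norm_num)).1 he
        refine ⟨d, ⟨⟨hd, by omega⟩, ?_⟩, rfl⟩
        by_contra hodd
        rw [Nat.not_odd_iff_even] at hodd
        obtain ⟨t, ht⟩ := hodd
        apply hne'
        refine ⟨t, ?_⟩
        rw [← Nat.mul_div_cancel' hd, ht]; ring
      · exfalso
        apply hne'
        refine Nat.Coprime.dvd_of_dvd_mul_left ?_ he
        simp
    · rintro ⟨d, ⟨⟨hd, -⟩, hodd⟩, rfl⟩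
      refine ⟨⟨Nat.mul_dvd_mul_left 2 hd, by omega⟩, ?_⟩
      rintro ⟨⟨t, ht⟩, -⟩
      have hd0 : 0 < d := Nat.pos_of_dvd_of_pos hd hk
      have : k / d = 2 * t := by
        apply Nat.div_eq_of_eq_mul_right hd0
        rw [ht]; ring
      rw [this] at hodd
      rw [Nat.odd_iff] at hodd
      omega
  rw [h4, Finset.prod_image (by intro x _ y _ h; simpa using h)] at h3
  have : ((∏ d ∈ k.divisors with Odd (k / d), Psi a d : ℕ) : ℤ) = ((a ^ k + 1 : ℕ) : ℤ) := by
    push_cast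
    rw [← h3]
    exact Finset.prod_congr rfl fun d _ => Psi_cast a d ha
  exact_mod_cast this

/-- the lcm -/
def LL (a n : ℕ) : ℕ := Finset.lcm (Finset.Icc 1 n) (fun k => a ^ k + 1)

lemma LL_dvd (a n : ℕ) (ha : 2 ≤ a) : LL a n ∣ ∏ m ∈ Finset.Icc 1 n, Psi a m := by
  apply Finset.lcm_dvd
  intro k hk
  rw [Finset.mem_Icc] at hk
  rw [← prod_Psi a k ha (by omega)]
  apply Finset.prod_dvd_prod_of_subset
  intro d hd
  rw [Finset.mem_filter, Nat.mem_divisors] at hd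
  rw [Finset.mem_Icc]
  exact ⟨Nat.pos_of_dvd_of_pos hd.1.1 (by omega), (Nat.le_of_dvd (by omega) hd.1.1).trans hk.2⟩

lemma LL_pos (a n : ℕ) (ha : 2 ≤ a) : 0 < LL a n :=
  Nat.pos_of_dvd_of_pos (LL_dvd a n ha) (Finset.prod_pos fun m _ => Psi_pos a m ha)

lemma Psi_dvd (a n m : ℕ) (ha : 2 ≤ a) (hm : m ∈ Finset.Icc 1 n) : Psi a m ∣ LL a n := by
  have h1 : Psi a m ∣ a ^ m + 1 := by
    rw [Finset.mem_Icc] at hm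
    rw [← prod_Psi a m ha (by omega)]
    apply Finset.dvd_prod_of_mem
    simp [Nat.div_self (show 0 < m by omega)]
    omega
  exact h1.trans (Finset.dvd_lcm (f := fun k => a ^ k + 1) hm)

lemma coprime_aux (a d m : ℕ) (ha : 2 ≤ a) (hd : 0 < d) (hdm : d < m) :
    Nat.Coprime (Psi a d / Nat.gcd (Psi a d) (2 * d)) (Psi a m / Nat.gcd (Psi a m) (2 * m)) := by
  apply Nat.coprime_of_dvd
  intro p hp h1 h2
  have h1' : p ∣ Psi a d := h1.trans (Nat.div_dvd_of_dvd (Nat.gcd_dvd_left _ _))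
  have h2' : p ∣ Psi a m := h2.trans (Nat.div_dvd_of_dvd (Nat.gcd_dvd_left _ _))
  have h3 : p ∣ 2 * m := by
    refine lemA a ha p (2 * d) (2 * m) (by omega) (by omega) ?_ ?_
    · rw [← Psi_cast a d ha]; exact_mod_cast h1'
    · rw [← Psi_cast a m ha]; exact_mod_cast h2'
  have h4 : p ^ 2 ∣ Psi a m := by
    rw [← Nat.div_mul_cancel (Nat.gcd_dvd_left (Psi a m) (2 * m)), pow_two]
    exact Nat.mul_dvd_mul h2 (Nat.dvd_gcd h2' h3)
  refine lemB a ha p m hp (by omega) h3 ?_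
  rw [← Psi_cast a m ha]; exact_mod_cast h4

lemma prod_le (a n : ℕ) (ha : 2 ≤ a) : ∏ m ∈ Finset.Icc 1 n, Psi a m ≤ LL a n * (2 * n) ^ n := by
  have h1 : ∏ m ∈ Finset.Icc 1 n, (Psi a m / Nat.gcd (Psi a m) (2 * m)) ∣ LL a n := by
    apply Finset.prod_dvd_of_isRelPrime
    · intro i hi j hj hij
      simp only [Finset.coe_Icc, Set.mem_Icc] at hi hj
      change IsRelPrime _ _
      rw [← Nat.coprime_iff_isRelPrime]
      rcases lt_or_gt_of_ne hij with h | h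
      · exact coprime_aux a i j ha (by omega) h
      · exact (coprime_aux a j i ha (by omega) h).symm
    · intro m hm
      exact (Nat.div_dvd_of_dvd (Nat.gcd_dvd_left _ _)).trans (Psi_dvd a n m ha hm)
  have h2 : ∏ m ∈ Finset.Icc 1 n, Nat.gcd (Psi a m) (2 * m) ≤ (2 * n) ^ n := by
    calc _ ≤ ∏ m ∈ Finset.Icc 1 n, (2 * n) := by
          apply Finset.prod_le_prod' 
          intro m hm
          rw [Finset.mem_Icc] at hm
          exact (Nat.gcd_le_right _ (by omega)).trans (by omega)
      _ = _ := by simp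
  calc _ = (∏ m ∈ Finset.Icc 1 n, (Psi a m / Nat.gcd (Psi a m) (2 * m))) * ∏ m ∈ Finset.Icc 1 n, Nat.gcd (Psi a m) (2 * m) := by
        rw [← Finset.prod_mul_distrib]
        exact Finset.prod_congr rfl fun m _ => (Nat.div_mul_cancel (Nat.gcd_dvd_left _ _)).symm
    _ ≤ _ := Nat.mul_le_mul (Nat.le_of_dvd (LL_pos a n ha) h1) h2
end LcmAux

namespace LcmAux
open ArithmeticFunction

noncomputable def ell (a : ℕ) : ArithmeticFunction ℝ :=
  ⟨fun k => if k = 0 then 0 else Real.log ((a : ℝ) ^ k + 1), by simp⟩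

noncomputable def gg (a : ℕ) : ArithmeticFunction ℝ :=
  ⟨fun k => if k = 0 then 0 else Real.log (Psi a k), by simp⟩

noncomputable def oo : ArithmeticFunction ℝ :=
  ⟨fun k => if Odd k then 1 else 0, by simp⟩

noncomputable def cc : ArithmeticFunction ℝ :=
  ⟨fun k => if Odd k then (moebius k : ℝ) else 0, by simp⟩

lemma ell_apply (a k : ℕ) (hk : k ≠ 0) : ell a k = Real.log ((a : ℝ) ^ k + 1) := by
  simp [ell, hk]
lemma gg_apply (a k : ℕ) (hk : k ≠ 0) : gg a k = Real.log (Psi a k) := by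
  simp [gg, hk]
lemma oo_apply (k : ℕ) : oo k = if Odd k then 1 else 0 := rfl
lemma cc_apply (k : ℕ) : cc k = if Odd k then (moebius k : ℝ) else 0 := rfl

lemma cc_mul_oo : cc * oo = 1 := by
  ext n
  have hz : ((moebius : ArithmeticFunction ℝ) * (zeta : ArithmeticFunction ℝ)) n = (1 : ArithmeticFunction ℝ) n := by
    rw [coe_moebius_mul_coe_zeta]
  rcases Nat.even_or_odd n with hn | hn
  · rw [mul_apply, one_apply_ne (by rintro rfl; exact absurd hn (by decide))]
    apply Finset.sum_eq_zero
    rintro ⟨x, y⟩ hxy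
    rw [Nat.mem_divisorsAntidiagonal] at hxy
    simp only [cc_apply, oo_apply]
    simp only at hxy
    split_ifs with h1 h2
    · rw [← hxy.1] at hn
      exact absurd (h1.mul h2) (by simpa using hn)
    all_goals simp
  · rw [← hz, mul_apply, mul_apply]
    apply Finset.sum_congr rfl
    rintro ⟨x, y⟩ hxy
    rw [Nat.mem_divisorsAntidiagonal] at hxy
    simp only at hxy
    rw [← hxy.1, Nat.odd_mul] at hn
    have hy : y ≠ 0 := by rintro rfl; simp at hxy; omega
    simp [cc_apply, oo_apply, hn.1, hn.2, hy]

lemma oo_mul_gg (a : ℕ) (ha : 2 ≤ a) : oo * gg a = ell a := by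
  ext k
  rcases Nat.eq_zero_or_pos k with rfl | hk
  · simp
  rw [ell_apply a k hk.ne', mul_comm, mul_apply,
    Nat.sum_divisorsAntidiagonal (fun x y => gg a x * oo y)]
  have h := prod_Psi a k ha hk
  have h2 : (a : ℝ) ^ k + 1 = ∏ d ∈ k.divisors with Odd (k / d), (Psi a d : ℝ) := by
    exact_mod_cast h.symm
  rw [h2, Real.log_prod (fun d _ => by exact_mod_cast (Psi_pos a d ha).ne'), Finset.sum_filter]
  apply Finset.sum_congr rfl
  intro d hd
  have hd0 : d ≠ 0 := (Nat.pos_of_mem_divisors hd).ne'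
  rw [gg_apply a d hd0, oo_apply]
  split_ifs <;> simp

lemma cc_mul_ell (a : ℕ) (ha : 2 ≤ a) : cc * ell a = gg a := by
  rw [← oo_mul_gg a ha, ← mul_assoc, cc_mul_oo, one_mul]

noncomputable def SS (a q : ℕ) : ℝ := ∑ k ∈ Finset.Ioc 0 q, ell a k

lemma sum_gg (a n : ℕ) (ha : 2 ≤ a) :
    ∑ m ∈ Finset.Ioc 0 n, gg a m = ∑' d, cc d * SS a (n / d) := by
  rw [← cc_mul_ell a ha, sum_Ioc_mul_eq_sum_sum, tsum_eq_sum]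
  · rfl
  · intro d hd
    rw [Finset.mem_Ioc] at hd
    rcases Nat.eq_zero_or_pos d with rfl | h
    · simp
    · rw [Nat.div_eq_of_lt (by omega)]
      simp [SS]

lemma gauss (q : ℕ) : ∑ k ∈ Finset.Ioc 0 q, (k : ℝ) = (q : ℝ) * (q + 1) / 2 := by
  induction q with
  | zero => simp
  | succ n ih =>
    rw [Finset.sum_Ioc_succ_top (by omega), ih]
    push_cast; ring

lemma SS_lower (a q : ℕ) (ha : 2 ≤ a) : (q : ℝ) * (q + 1) / 2 * Real.log a ≤ SS a q := by
  rw [← gauss, Finset.sum_mul, SS]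
  apply Finset.sum_le_sum
  intro k hk
  rw [Finset.mem_Ioc] at hk
  rw [ell_apply a k (by omega), ← Real.log_pow]
  have : (0 : ℝ) < (a : ℝ) ^ k := by positivity
  exact Real.log_le_log this (by linarith)

lemma SS_upper (a q : ℕ) (ha : 2 ≤ a) :
    SS a q ≤ (q : ℝ) * (q + 1) / 2 * Real.log a + q * Real.log 2 := by
  have : (q : ℝ) * Real.log 2 = ∑ k ∈ Finset.Ioc 0 q, Real.log 2 := by simp
  rw [← gauss, Finset.sum_mul, this, ← Finset.sum_add_distrib, SS]
  apply Finset.sum_le_sum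
  intro k hk
  rw [Finset.mem_Ioc] at hk
  have h1 : (1 : ℝ) ≤ (a : ℝ) ^ k := one_le_pow₀ (by exact_mod_cast (by omega : 1 ≤ a))
  rw [ell_apply a k (by omega), ← Real.log_pow, ← Real.log_mul (by positivity) (by norm_num)]
  exact Real.log_le_log (by positivity) (by linarith)

lemma log_a_pos (a : ℕ) (ha : 2 ≤ a) : 0 < Real.log a :=
  Real.log_pos (by exact_mod_cast ha)

lemma SS_bound (a q : ℕ) (ha : 2 ≤ a) : |SS a q| ≤ (Real.log a + Real.log 2) * (q : ℝ) ^ 2 := by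
  have h1 := SS_lower a q ha
  have h2 := SS_upper a q ha
  have hl := log_a_pos a ha
  have hl2 : 0 < Real.log 2 := Real.log_pos (by norm_num)
  have h0 : 0 ≤ SS a q := le_trans (by positivity) h1
  rw [abs_of_nonneg h0]
  have hq : (q : ℝ) ≤ (q : ℝ) ^ 2 := by
    exact_mod_cast Nat.le_self_pow (by norm_num) q
  nlinarith

lemma SS_tendsto (a : ℕ) (ha : 2 ≤ a) :
    Tendsto (fun q : ℕ => SS a q / (q : ℝ) ^ 2) atTop (nhds (Real.log a / 2)) := by
  have hinv : Tendsto (fun q : ℕ => ((q : ℝ))⁻¹) atTop (nhds 0) := tendsto_inv_atTop_nhds_zero_nat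
  have hlow : Tendsto (fun q : ℕ => (1 + (q : ℝ)⁻¹) / 2 * Real.log a) atTop (nhds (Real.log a / 2)) := by
    have := ((hinv.const_add 1).div_const 2).mul_const (Real.log a)
    convert! this using 2; ring
  have hup : Tendsto (fun q : ℕ => (1 + (q : ℝ)⁻¹) / 2 * Real.log a + (q : ℝ)⁻¹ * Real.log 2) atTop
      (nhds (Real.log a / 2)) := by
    have := hlow.add (hinv.mul_const (Real.log 2))
    convert! this using 2; ring
  refine tendsto_of_tendsto_of_tendsto_of_le_of_le' hlow hup ?_ ?_
  · filter_upwards [eventually_gt_atTop 0] with q hq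
    have hq' : (0 : ℝ) < q := by exact_mod_cast hq
    rw [le_div_iff₀ (by positivity)]
    refine le_trans (le_of_eq ?_) (SS_lower a q ha)
    field_simp
  · filter_upwards [eventually_gt_atTop 0] with q hq
    have hq' : (0 : ℝ) < q := by exact_mod_cast hq
    rw [div_le_iff₀ (by positivity)]
    refine le_trans (SS_upper a q ha) (le_of_eq ?_)
    field_simp

lemma natdiv_tendsto (d : ℕ) : Tendsto (fun n : ℕ => ((n / d : ℕ) : ℝ) / n) atTop (nhds ((d : ℝ)⁻¹)) := by
  have h := (tendsto_nat_floor_mul_div_atTop (R := ℝ) (a := (d : ℝ)⁻¹) (by positivity)).comp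
    tendsto_natCast_atTop_atTop
  refine h.congr fun n => ?_
  simp only [Function.comp]
  rw [inv_mul_eq_div, Nat.floor_div_eq_div]

lemma term_tendsto (a d : ℕ) (ha : 2 ≤ a) :
    Tendsto (fun n : ℕ => cc d * SS a (n / d) / (n : ℝ) ^ 2) atTop
      (nhds (Real.log a / 2 * (cc d / (d : ℝ) ^ 2))) := by
  rcases Nat.eq_zero_or_pos d with rfl | hd
  · simp
  have h1 : Tendsto (fun n : ℕ => n / d) atTop atTop := Nat.tendsto_div_const_atTop hd.ne'
  have h2 := (((SS_tendsto a ha).comp h1).mul ((natdiv_tendsto d).pow 2)).const_mul (cc d)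
  have e : cc d * (Real.log a / 2 * (d : ℝ)⁻¹ ^ 2) = Real.log a / 2 * (cc d / (d : ℝ) ^ 2) := by
    rw [inv_pow, div_eq_mul_inv (cc d)]; ring
  rw [e] at h2
  refine h2.congr' ?_
  filter_upwards [eventually_ge_atTop d] with n hn
  have hq : 0 < n / d := Nat.div_pos hn hd
  have hq' : ((n / d : ℕ) : ℝ) ≠ 0 := by exact_mod_cast hq.ne'
  simp only [Function.comp]
  generalize ((n / d : ℕ) : ℝ) = x at *
  rw [div_pow]
  field_simp

lemma cc_abs (d : ℕ) : |cc d| ≤ 1 := by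
  rw [cc_apply]
  split_ifs
  · have := abs_moebius_le_one (n := d)
    exact_mod_cast this
  · simp

lemma main_tendsto (a : ℕ) (ha : 2 ≤ a) :
    Tendsto (fun n : ℕ => (∑ m ∈ Finset.Ioc 0 n, gg a m) / (n : ℝ) ^ 2) atTop
      (nhds (∑' d : ℕ, Real.log a / 2 * (cc d / (d : ℝ) ^ 2))) := by
  have hs : Summable (fun d : ℕ => (Real.log a + Real.log 2) * (1 / (d : ℝ) ^ 2)) :=
    (Real.summable_one_div_nat_pow.2 (by norm_num)).mul_left _
  have h := tendsto_tsum_of_dominated_convergence (𝓕 := atTop)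
    (f := fun (n d : ℕ) => cc d * SS a (n / d) / (n : ℝ) ^ 2) hs (fun d => term_tendsto a d ha) ?_
  · refine h.congr fun n => ?_
    rw [sum_gg a n ha, tsum_div_const]
  · filter_upwards [eventually_gt_atTop 0] with n hn d
    have hn' : (0 : ℝ) < n := by exact_mod_cast hn
    rcases Nat.eq_zero_or_pos d with rfl | hd
    · simp
    have hd' : (0 : ℝ) < d := by exact_mod_cast hd
    have hl := log_a_pos a ha
    have hl2 : 0 < Real.log 2 := Real.log_pos (by norm_num)
    rw [Real.norm_eq_abs, abs_div, abs_mul, abs_of_pos (show (0 : ℝ) < (n : ℝ) ^ 2 by positivity),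
      div_le_iff₀ (by positivity)]
    have hdiv : ((n / d : ℕ) : ℝ) ≤ (n : ℝ) / d := Nat.cast_div_le
    calc |cc d| * |SS a (n / d)| ≤ 1 * ((Real.log a + Real.log 2) * ((n / d : ℕ) : ℝ) ^ 2) :=
          mul_le_mul (cc_abs d) (SS_bound a _ ha) (abs_nonneg _) zero_le_one
      _ ≤ 1 * ((Real.log a + Real.log 2) * ((n : ℝ) / d) ^ 2) := by gcongr
      _ = _ := by field_simp

lemma cc_tsum : ∑' d : ℕ, cc d / (d : ℝ) ^ 2 = 8 / Real.pi ^ 2 := by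
  have hs : 1 < (2 : ℂ).re := by norm_num
  have h1 := DirichletCharacter.LSeries.mul_mu_eq_one (1 : DirichletCharacter ℂ 2) hs
  have h2 := DirichletCharacter.LFunction_eq_LSeries (1 : DirichletCharacter ℂ 2) hs
  have h3 := DirichletCharacter.LFunctionTrivChar_eq_mul_riemannZeta (N := 2) (s := 2) (by norm_num)
  rw [DirichletCharacter.LFunctionTrivChar, h2, riemannZeta_two, Nat.Prime.primeFactors Nat.prime_two,
    Finset.prod_singleton] at h3
  rw [h3] at h1
  have h4 : LSeries ((fun n : ℕ => (1 : DirichletCharacter ℂ 2) (n : ZMod 2)) * fun n => (moebius n : ℂ)) 2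
      = ((∑' d : ℕ, cc d / (d : ℝ) ^ 2 : ℝ) : ℂ) := by
    rw [LSeries, Complex.ofReal_tsum]
    apply tsum_congr
    intro d
    rcases Nat.eq_zero_or_pos d with rfl | hd
    · simp
    rw [LSeries.term_of_ne_zero hd.ne', cc_apply]
    have : (1 : DirichletCharacter ℂ 2) (d : ZMod 2) = if Odd d then 1 else 0 := by
      split_ifs with h
      · rw [ZMod.natCast_eq_one_iff_odd.2 h, map_one]
      · rw [Nat.not_odd_iff_even] at h
        rw [ZMod.natCast_eq_zero_iff_even.2 h, MulChar.map_zero]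
    simp only [Pi.mul_apply, this]
    have e : (d : ℂ) ^ (2 : ℂ) = (d : ℂ) ^ 2 := by
      exact_mod_cast Complex.cpow_natCast (d : ℂ) 2
    rw [e]
    split_ifs <;> simp
  rw [h4] at h1
  have e : ((2 : ℕ) : ℂ) ^ (-2 : ℂ) = 1 / 4 := by
    rw [Complex.cpow_neg]
    have : ((2 : ℕ) : ℂ) ^ (2 : ℂ) = ((2 : ℕ) : ℂ) ^ 2 := by
      exact_mod_cast Complex.cpow_natCast ((2 : ℕ) : ℂ) 2
    rw [this]; norm_num
  rw [e] at h1
  generalize ∑' d : ℕ, cc d / (d : ℝ) ^ 2 = A at h1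
  have h5 : (1 - 1 / 4) * (Real.pi ^ 2 / 6) * A = 1 := by
    apply Complex.ofReal_injective
    push_cast
    exact h1
  have hpi := Real.pi_pos
  field_simp at h5 ⊢
  linarith

lemma log_prod_eq (a n : ℕ) (ha : 2 ≤ a) :
    Real.log ((∏ m ∈ Finset.Icc 1 n, Psi a m : ℕ) : ℝ) = ∑ m ∈ Finset.Ioc 0 n, gg a m := by
  rw [Nat.cast_prod, Real.log_prod (fun d _ => by exact_mod_cast (Psi_pos a d ha).ne')]
  apply Finset.sum_congr
  · ext x; simp [Nat.succ_le_iff]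
  · intro m hm
    rw [Finset.mem_Ioc] at hm
    rw [gg_apply a m (by omega)]

lemma LL_tendsto (a : ℕ) (ha : 2 ≤ a) :
    Tendsto (fun n : ℕ => Real.log (LL a n) / (n : ℝ) ^ 2) atTop
      (nhds (4 * Real.log a / Real.pi ^ 2)) := by
  have hmain := main_tendsto a ha
  rw [tsum_mul_left, cc_tsum] at hmain
  have e : Real.log a / 2 * (8 / Real.pi ^ 2) = 4 * Real.log a / Real.pi ^ 2 := by ring
  rw [e] at hmain
  have herr : Tendsto (fun n : ℕ => Real.log (2 * n) / (n : ℝ)) atTop (nhds 0) := by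
    have h0 : Tendsto (fun x : ℝ => Real.log x / x) atTop (nhds 0) := by
      simpa using Real.isLittleO_log_id_atTop.tendsto_div_nhds_zero
    have h1 : Tendsto (fun n : ℕ => 2 * (n : ℝ)) atTop atTop :=
      tendsto_natCast_atTop_atTop.const_mul_atTop (by norm_num)
    have h2 := (h0.comp h1).const_mul 2
    rw [mul_zero] at h2
    refine h2.congr fun n => ?_
    simp only [Function.comp]
    rw [mul_div_assoc', mul_div_mul_left _ _ (by norm_num)]
  have hlow := hmain.sub herr
  rw [sub_zero] at hlow
  refine tendsto_of_tendsto_of_tendsto_of_le_of_le' hlow hmain ?_ ?_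
  · filter_upwards [eventually_gt_atTop 0] with n hn
    have hn' : (0 : ℝ) < n := by exact_mod_cast hn
    have hL : (0 : ℝ) < LL a n := by exact_mod_cast LL_pos a n ha
    have h1 : ((∏ m ∈ Finset.Icc 1 n, Psi a m : ℕ) : ℝ) ≤ LL a n * (2 * n) ^ n := by
      exact_mod_cast prod_le a n ha
    have h0 : (0 : ℝ) < ((∏ m ∈ Finset.Icc 1 n, Psi a m : ℕ) : ℝ) := by
      exact_mod_cast Finset.prod_pos fun m _ => Psi_pos a m ha
    have h2 := Real.log_le_log h0 h1
    rw [log_prod_eq a n ha, Real.log_mul hL.ne' (by positivity), Real.log_pow] at h2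
    have : Real.log (2 * n) / (n : ℝ) = n * Real.log (2 * n) / (n : ℝ) ^ 2 := by field_simp
    rw [this, ← sub_div]
    gcongr
    linarith
  · filter_upwards with n
    have hL : (0 : ℝ) < LL a n := by exact_mod_cast LL_pos a n ha
    rw [← log_prod_eq a n ha]
    have h1 : (LL a n : ℝ) ≤ ((∏ m ∈ Finset.Icc 1 n, Psi a m : ℕ) : ℝ) := by
      exact_mod_cast Nat.le_of_dvd (Finset.prod_pos fun m _ => Psi_pos a m ha) (LL_dvd a n ha)
    gcongr

end LcmAux

theorem stmt_14 (a : ℕ) (ha : 2 ≤ a) :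
    Tendsto (fun n : ℕ =>
        Real.log (Finset.lcm (Finset.Icc 1 n) (fun k => a ^ k + 1) : ℕ) /
          ((4 * Real.log a / Real.pi ^ 2) * (n : ℝ) ^ 2))
      atTop (nhds 1) := by
  have h := LcmAux.LL_tendsto a ha
  have hpos : 4 * Real.log a / Real.pi ^ 2 ≠ 0 := by
    have := LcmAux.log_a_pos a ha
    have := Real.pi_pos
    positivity
  have h2 := h.div_const (4 * Real.log a / Real.pi ^ 2)
  rw [div_self hpos] at h2
  refine h2.congr fun n => ?_
  rw [div_div, mul_comm ((n : ℝ) ^ 2)]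
  rfl
end

section
/- Let r, m be positive integers and z = 0. Then ∑_{n ≤ x, n ≡ r (mod m)} φ(n) = (3/π²) · c_{r,m} · x² + O_{r,m}(x log x) for every x ≥ 2, where c_{r,m} = (1/m) · ∏_{p ∣ m, p ∣ r} (1 + 1/p)^{−1} · ∏_{p ∣ m, p ∤ r} (1 − 1/p²)^{−1}, the products being over primes p. -/
lemma aux_window (q v N : ℕ) (hq : 1 ≤ q) :
    ∃ e, N < e ∧ e ≤ N + q ∧
      (Finset.Ioc N (N + q)).filter (fun n => n % q = v % q) = {e} := by
  have hex : ∃ e, N < e ∧ e ≤ N + q ∧ e % q = v % q := by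
    refine ⟨N + 1 + (v + q * (N + 1) - (N + 1)) % q, by omega, ?_, ?_⟩
    · have := Nat.mod_lt (v + q * (N + 1) - (N + 1)) hq
      omega
    · have h1 : N + 1 ≤ q * (N + 1) := Nat.le_mul_of_pos_left _ hq
      rw [Nat.add_mod_mod]
      rw [show N + 1 + (v + q * (N + 1) - (N + 1)) = v + q * (N + 1) by omega]
      simp
  obtain ⟨e, h1, h2, h3⟩ := hex
  refine ⟨e, h1, h2, ?_⟩
  ext a
  simp only [Finset.mem_filter, Finset.mem_Ioc, Finset.mem_singleton]
  constructor
  · rintro ⟨⟨ha1, ha2⟩, ha3⟩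
    have h : a ≡ e [MOD q] := ha3.trans h3.symm
    rcases le_total a e with hle | hle
    · have := (Nat.modEq_iff_dvd' hle).1 h
      have := Nat.eq_zero_of_dvd_of_lt this (by omega)
      omega
    · have := (Nat.modEq_iff_dvd' hle).1 h.symm
      have := Nat.eq_zero_of_dvd_of_lt this (by omega)
      omega
  · rintro rfl
    exact ⟨⟨h1, h2⟩, h3⟩

lemma aux_APnat (q v : ℕ) (hq : 1 ≤ q) (N : ℕ) :
    |(∑ e ∈ (Finset.Ioc 0 N).filter (fun n => n % q = v % q), (e : ℝ)) -
      (N : ℝ) ^ 2 / (2 * q)| ≤ (N : ℝ) := by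
  have hq0 : (0 : ℝ) < q := by exact_mod_cast hq
  induction N using Nat.strong_induction_on with
  | _ N ih =>
    rcases lt_or_ge N q with h | h
    · have hNq : (N : ℝ) ≤ q := by exact_mod_cast h.le
      obtain ⟨e, h1, h2, h3⟩ := aux_window q v 0 hq
      have hsub : (Finset.Ioc 0 N).filter (fun n => n % q = v % q) ⊆ {e} := by
        rw [← h3]
        apply Finset.filter_subset_filter
        apply Finset.Ioc_subset_Ioc le_rfl (by omega)
      have hS : 0 ≤ (∑ e ∈ (Finset.Ioc 0 N).filter (fun n => n % q = v % q), (e : ℝ)) :=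
        Finset.sum_nonneg fun _ _ => Nat.cast_nonneg _
      have hS2 : (∑ e ∈ (Finset.Ioc 0 N).filter (fun n => n % q = v % q), (e : ℝ)) ≤ N := by
        rcases Finset.subset_singleton_iff.1 hsub with h' | h'
        · rw [h']; simp
        · have : e ∈ (Finset.Ioc 0 N).filter (fun n => n % q = v % q) := by rw [h']; simp
          simp only [Finset.mem_filter, Finset.mem_Ioc] at this
          rw [h']; simp [this.1.2]
      have h5 : (N : ℝ) ^ 2 / (2 * q) ≤ N := by
        rw [div_le_iff₀ (by positivity)]
        nlinarith [Nat.cast_nonneg (α := ℝ) N]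
      have h6 : 0 ≤ (N : ℝ) ^ 2 / (2 * q) := by positivity
      rw [abs_le]
      constructor <;> linarith
    · obtain ⟨M, rfl⟩ : ∃ M, N = M + q := ⟨N - q, by omega⟩
      have hM := ih M (by omega)
      obtain ⟨e, h1, h2, h3⟩ := aux_window q v M hq
      have hsplit : (∑ e ∈ (Finset.Ioc 0 (M + q)).filter (fun n => n % q = v % q), (e : ℝ)) =
          (∑ e ∈ (Finset.Ioc 0 M).filter (fun n => n % q = v % q), (e : ℝ)) + e := by
        rw [← Finset.Ioc_union_Ioc_eq_Ioc (Nat.zero_le M) (Nat.le_add_right M q),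
          Finset.filter_union, Finset.sum_union, h3, Finset.sum_singleton]
        apply Finset.disjoint_filter_filter
        rw [Finset.disjoint_left]
        intro a
        simp only [Finset.mem_Ioc]
        omega
      have h1' : (M : ℝ) ≤ e := by exact_mod_cast h1.le
      have h2' : (e : ℝ) ≤ M + q := by exact_mod_cast h2
      have h7 : ((M + q : ℕ) : ℝ) ^ 2 / (2 * q) = (M : ℝ) ^ 2 / (2 * q) + M + q / 2 := by
        push_cast
        field_simp
        ring
      rw [hsplit, h7]
      push_cast
      rw [abs_le] at hM ⊢
      constructor <;> linarith [hM.1, hM.2]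

lemma aux_AP (q v : ℕ) (hq : 1 ≤ q) (y : ℝ) (hy : 1 ≤ y) :
    |(∑ e ∈ (Finset.Ioc 0 ⌊y⌋₊).filter (fun n => n % q = v % q), (e : ℝ)) -
      y ^ 2 / (2 * q)| ≤ 2 * y := by
  have hq0 : (1 : ℝ) ≤ q := by exact_mod_cast hq
  have h := aux_APnat q v hq ⌊y⌋₊
  have h1 := Nat.floor_le (by linarith : 0 ≤ y)
  have h2 := Nat.lt_floor_add_one y
  have h3 : y ^ 2 / (2 * q) - (⌊y⌋₊ : ℝ) ^ 2 / (2 * q) ≤ y := by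
    rw [← sub_div, div_le_iff₀ (by positivity)]
    nlinarith [Nat.cast_nonneg (α := ℝ) ⌊y⌋₊]
  have h4 : (⌊y⌋₊ : ℝ) ^ 2 / (2 * q) ≤ y ^ 2 / (2 * q) := by gcongr
  rw [abs_le] at h ⊢
  constructor <;> linarith [h.1, h.2]

/-- The number of solutions of `d e ≡ r (mod m)`. -/
def auxW (r m d : ℕ) : ℕ := if Nat.gcd m d ∣ r then Nat.gcd m d else 0

lemma aux_inner (r m : ℕ) (hm : 1 ≤ m) (d : ℕ) (y : ℝ) (hy : 1 ≤ y) :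
    |(∑ e ∈ (Finset.Ioc 0 ⌊y⌋₊).filter (fun n => (d * n) % m = r % m), (e : ℝ)) -
      (auxW r m d : ℝ) / (2 * m) * y ^ 2| ≤ 2 * y := by
  unfold auxW
  have hg : 0 < Nat.gcd m d := Nat.gcd_pos_of_pos_left _ hm
  obtain ⟨m', hm'⟩ := Nat.gcd_dvd_left m d
  obtain ⟨d', hd'⟩ := Nat.gcd_dvd_right m d
  have hcop : Nat.Coprime d' m' := by
    have h := Nat.coprime_div_gcd_div_gcd hg
    rw [Nat.div_eq_of_eq_mul_right hg hm', Nat.div_eq_of_eq_mul_right hg hd'] at h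
    exact h.symm
  set g := Nat.gcd m d with hgdef
  have hm'0 : 1 ≤ m' := by
    rcases Nat.eq_zero_or_pos m' with h | h
    · rw [h] at hm'; omega
    · exact h
  split_ifs with hr
  · obtain ⟨r', hr'⟩ := hr
    obtain ⟨v, -, hv⟩ := Nat.exists_mul_mod_eq_of_coprime r' hcop (by omega)
    have hiff : ∀ n, (d * n) % m = r % m ↔ n % m' = v % m' := by
      intro n
      change d * n ≡ r [MOD m] ↔ n ≡ v [MOD m']
      rw [hm', hr', hd', mul_assoc, Nat.ModEq.mul_left_cancel_iff' hg.ne']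
      have hv' : d' * v ≡ r' [MOD m'] := hv
      constructor
      · intro h
        exact Nat.ModEq.cancel_left_of_coprime hcop.symm (h.trans hv'.symm)
      · intro h
        exact (h.mul_left d').trans hv'
    simp only [hiff]
    have := aux_AP m' v hm'0 y hy
    convert this using 3
    have hmR : (m : ℝ) = g * m' := by exact_mod_cast hm'
    rw [hmR]
    have : (0 : ℝ) < g := by exact_mod_cast hg
    have : (0 : ℝ) < m' := by exact_mod_cast hm'0
    field_simp
  · have : (Finset.Ioc 0 ⌊y⌋₊).filter (fun n => (d * n) % m = r % m) = ∅ := by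
      rw [Finset.filter_eq_empty_iff]
      intro n _ h
      apply hr
      have h' : d * n ≡ r [MOD m] := h
      have h2 := h'.of_dvd (Dvd.intro _ hm'.symm)
      have h3 : g ∣ d * n := Dvd.dvd.mul_right (Dvd.intro _ hd'.symm) n
      exact (h2.dvd_iff dvd_rfl).1 h3
    rw [this]
    simp
    linarith

lemma aux_swap (F : ℕ → ℕ → ℝ) (N : ℕ) :
    ∑ n ∈ Finset.Ioc 0 N, ∑ p ∈ n.divisorsAntidiagonal, F p.1 p.2 =
      ∑ d ∈ Finset.Ioc 0 N, ∑ e ∈ Finset.Ioc 0 (N / d), F d e := by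
  rw [Finset.sum_sigma', Finset.sum_sigma']
  refine Finset.sum_nbij' (fun a => ⟨a.2.1, a.2.2⟩) (fun b => ⟨b.1 * b.2, (b.1, b.2)⟩) ?_ ?_ ?_ ?_ ?_
  · rintro ⟨n, d, e⟩ h
    simp only [Finset.mem_sigma, Finset.mem_Ioc, Nat.mem_divisorsAntidiagonal] at h ⊢
    obtain ⟨⟨h1, h2⟩, h3, h4⟩ := h
    subst h3
    have hd : 0 < d := Nat.pos_of_mul_pos_right h1
    have he : 0 < e := Nat.pos_of_mul_pos_left h1
    refine ⟨⟨hd, le_trans (Nat.le_mul_of_pos_right d he) h2⟩, he, ?_⟩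
    rw [Nat.le_div_iff_mul_le hd, mul_comm]
    exact h2
  · rintro ⟨d, e⟩ h
    simp only [Finset.mem_sigma, Finset.mem_Ioc, Nat.mem_divisorsAntidiagonal] at h ⊢
    obtain ⟨⟨h1, h2⟩, h3, h4⟩ := h
    rw [Nat.le_div_iff_mul_le h1, mul_comm] at h4
    have := Nat.mul_pos h1 h3
    exact ⟨⟨this, h4⟩, trivial, this.ne'⟩
  · rintro ⟨n, d, e⟩ h
    simp only [Finset.mem_sigma, Finset.mem_Ioc, Nat.mem_divisorsAntidiagonal] at h
    obtain ⟨⟨h1, h2⟩, h3, h4⟩ := h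
    subst h3
    rfl
  · rintro ⟨d, e⟩ h
    rfl
  · rintro ⟨n, d, e⟩ h
    rfl

lemma aux_totient (n : ℕ) (hn : 0 < n) :
    (Nat.totient n : ℝ) =
      ∑ p ∈ n.divisorsAntidiagonal, (ArithmeticFunction.moebius p.1 : ℝ) * (p.2 : ℝ) := by
  have h := (ArithmeticFunction.sum_eq_iff_sum_mul_moebius_eq
    (f := fun n => (Nat.totient n : ℝ)) (g := fun n => (n : ℝ))).1 (by
      intro n hn
      exact_mod_cast Nat.sum_totient n) n hn
  exact h.symm

lemma aux_sum (r m N : ℕ) :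
    ∑ n ∈ (Finset.Icc 1 N).filter (fun n => n % m = r % m), (Nat.totient n : ℝ) =
      ∑ d ∈ Finset.Ioc 0 N, (ArithmeticFunction.moebius d : ℝ) *
        ∑ e ∈ (Finset.Ioc 0 (N / d)).filter (fun n => (d * n) % m = r % m), (e : ℝ) := by
  have h := aux_swap (fun d e => if (d * e) % m = r % m then
    (ArithmeticFunction.moebius d : ℝ) * (e : ℝ) else 0) N
  simp only [Finset.mul_sum, Finset.sum_filter] at h ⊢
  simp only [mul_ite, mul_zero]
  rw [← h]
  apply Finset.sum_congr rfl
  intro n hn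
  have hn' : 0 < n := (Finset.mem_Ioc.1 hn).1
  rw [aux_totient n hn']
  split_ifs with hc
  · apply Finset.sum_congr rfl
    intro p hp
    rw [(Nat.mem_divisorsAntidiagonal.1 hp).1, if_pos hc]
  · symm
    apply Finset.sum_eq_zero
    intro p hp
    rw [(Nat.mem_divisorsAntidiagonal.1 hp).1, if_neg hc]

lemma auxW_le (r m : ℕ) (hm : 1 ≤ m) (d : ℕ) : auxW r m d ≤ m := by
  unfold auxW
  split_ifs
  · exact Nat.gcd_le_left _ hm
  · omega

lemma auxW_mul (r m : ℕ) {a b : ℕ} (h : Nat.Coprime a b) :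
    auxW r m (a * b) = auxW r m a * auxW r m b := by
  unfold auxW
  rw [Nat.Coprime.gcd_mul m h]
  have hc : Nat.Coprime (Nat.gcd m a) (Nat.gcd m b) :=
    Nat.Coprime.coprime_dvd_left (Nat.gcd_dvd_right _ _)
      (Nat.Coprime.coprime_dvd_right (Nat.gcd_dvd_right _ _) h)
  by_cases ha : Nat.gcd m a ∣ r
  · by_cases hb : Nat.gcd m b ∣ r
    · rw [if_pos ha, if_pos hb, if_pos (hc.mul_dvd_of_dvd_of_dvd ha hb)]
    · rw [if_neg hb, if_neg, mul_zero]
      exact fun h => hb ((Dvd.intro_left _ rfl).trans h)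
  · rw [if_neg ha, if_neg, zero_mul]
    exact fun h => ha ((Dvd.intro _ rfl).trans h)

/-- The coefficients of the singular series. -/
noncomputable def auxF (r m d : ℕ) : ℝ :=
  (ArithmeticFunction.moebius d : ℝ) * (auxW r m d : ℝ) * ((d : ℝ) ^ 2)⁻¹

lemma auxF_abs (r m : ℕ) (hm : 1 ≤ m) (d : ℕ) : |auxF r m d| ≤ m * ((d : ℝ) ^ 2)⁻¹ := by
  unfold auxF
  have h1 : |(ArithmeticFunction.moebius d : ℝ)| ≤ 1 := by
    exact_mod_cast (ArithmeticFunction.abs_moebius_le_one (n := d))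
  have h2 : (auxW r m d : ℝ) ≤ m := by exact_mod_cast auxW_le r m hm d
  rw [abs_mul, abs_mul, abs_of_nonneg (by positivity : 0 ≤ ((d : ℝ) ^ 2)⁻¹),
    abs_of_nonneg (by positivity : 0 ≤ (auxW r m d : ℝ))]
  have : |(ArithmeticFunction.moebius d : ℝ)| * (auxW r m d : ℝ) ≤ 1 * m := by gcongr
  rw [one_mul] at this
  gcongr

lemma auxF_summable (r m : ℕ) (hm : 1 ≤ m) : Summable (fun d => ‖auxF r m d‖) := by
  have h : Summable (fun d : ℕ => (m : ℝ) * ((d : ℝ) ^ 2)⁻¹) :=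
    (Real.summable_nat_pow_inv.2 (by norm_num)).mul_left _
  exact Summable.of_nonneg_of_le (fun _ => norm_nonneg _) (fun d => auxF_abs r m hm d) h

lemma auxF_tail (r m : ℕ) (hm : 1 ≤ m) (N : ℕ) (hN : 1 ≤ N) :
    |∑ d ∈ Finset.Ioc 0 N, auxF r m d - ∑' d, auxF r m d| ≤ m * (N : ℝ)⁻¹ := by
  have hs : Summable (auxF r m) := (auxF_summable r m hm).of_norm
  have h0 : auxF r m 0 = 0 := by simp [auxF]
  have ht := (hs.hasSum.tendsto_sum_nat.comp (Filter.tendsto_add_atTop_nat 1))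
  have ht2 := ((tendsto_const_nhds (x := ∑ d ∈ Finset.Ioc 0 N, auxF r m d)).sub ht).abs
  refine le_of_tendsto ht2 ?_
  filter_upwards [Filter.eventually_ge_atTop N] with M hM
  have e1 : ∑ d ∈ Finset.range (M + 1), auxF r m d = ∑ d ∈ Finset.Ioc 0 M, auxF r m d := by
    rw [Finset.sum_range_succ', h0, add_zero, Finset.range_eq_Ico,
      Finset.sum_Ico_add' (fun d => auxF r m d) 0 M 1]
    apply Finset.sum_congr _ (fun _ _ => rfl)
    ext a; simp only [Finset.mem_Ico, Finset.mem_Ioc]; omega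
  simp only [Function.comp]
  rw [e1, ← Finset.Ioc_union_Ioc_eq_Ioc (Nat.zero_le N) hM, Finset.sum_union, sub_add_cancel_left,
    abs_neg]
  · calc |∑ d ∈ Finset.Ioc N M, auxF r m d| ≤ ∑ d ∈ Finset.Ioc N M, |auxF r m d| :=
          Finset.abs_sum_le_sum_abs _ _
      _ ≤ ∑ d ∈ Finset.Ioc N M, (m : ℝ) * ((d : ℝ) ^ 2)⁻¹ :=
          Finset.sum_le_sum fun d _ => auxF_abs r m hm d
      _ = m * ∑ d ∈ Finset.Ioc N M, ((d : ℝ) ^ 2)⁻¹ := by rw [Finset.mul_sum]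
      _ ≤ m * ((N : ℝ)⁻¹ - (M : ℝ)⁻¹) := by
          gcongr
          exact sum_Ioc_inv_sq_le_sub (by omega) hM
      _ ≤ m * (N : ℝ)⁻¹ := by
          gcongr
          have : 0 ≤ (M : ℝ)⁻¹ := by positivity
          linarith
  · rw [Finset.disjoint_left]
    intro a
    simp only [Finset.mem_Ioc]
    omega

/-- The function `n ↦ n⁻²` as a monoid homomorphism. -/
noncomputable def auxZ : ℕ →*₀ ℝ where
  toFun n := 1 / (n : ℝ) ^ 2
  map_zero' := by simp
  map_one' := by simp
  map_mul' a b := by push_cast; rw [mul_pow]; field_simp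

lemma aux_zeta : HasProd (fun p : Nat.Primes => (1 - 1 / ((p : ℕ) : ℝ) ^ 2)⁻¹) (Real.pi ^ 2 / 6) := by
  have hs : Summable (fun n => ‖auxZ n‖) := hasSum_zeta_two.summable.norm
  have h := EulerProduct.eulerProduct_completely_multiplicative_hasProd hs
  have h2 : ∑' n, auxZ n = Real.pi ^ 2 / 6 := hasSum_zeta_two.tsum_eq
  rw [h2] at h
  exact h

/-- The local factors away from the zeta function. -/
noncomputable def auxH (r m p : ℕ) : ℝ :=
  if p ∣ m then (if p ∣ r then (1 + 1 / (p : ℝ))⁻¹ else (1 - 1 / (p : ℝ) ^ 2)⁻¹) else 1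

lemma auxF_local (r m p : ℕ) (hp : p.Prime) :
    (∑' e, auxF r m (p ^ e)) * (1 - 1 / (p : ℝ) ^ 2)⁻¹ = auxH r m p := by
  have hp1 : (1 : ℝ) < p := by exact_mod_cast hp.one_lt
  have hts : ∑' e, auxF r m (p ^ e) = auxF r m 1 + auxF r m p := by
    rw [tsum_eq_sum (s := Finset.range 2)]
    · rw [Finset.sum_range_succ, Finset.sum_range_one, pow_zero, pow_one]
    · intro e he
      have he' : 1 < e := by simpa using he
      unfold auxF
      rw [ArithmeticFunction.moebius_apply_prime_pow hp (by omega), if_neg (by omega)]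
      simp
  have h1 : auxF r m 1 = 1 := by simp [auxF, auxW]
  have hmp : auxF r m p = - (auxW r m p : ℝ) * ((p : ℝ) ^ 2)⁻¹ := by
    unfold auxF
    rw [ArithmeticFunction.moebius_apply_prime hp]
    simp
  rw [hts, h1, hmp]
  have hne : (p : ℝ) ^ 2 - 1 ≠ 0 := by nlinarith
  have hne2 : (p : ℝ) - 1 ≠ 0 := by linarith
  have hne3 : (p : ℝ) + 1 ≠ 0 := by linarith
  have hne0 : (p : ℝ) ≠ 0 := by linarith
  have hA : (1 - 1 / (p : ℝ) ^ 2) ≠ 0 := by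
    have : 1 - 1 / (p : ℝ) ^ 2 = (p ^ 2 - 1) / p ^ 2 := by field_simp
    rw [this]
    positivity
  unfold auxH auxW
  by_cases hm : p ∣ m
  · rw [Nat.gcd_eq_right hm, if_pos hm]
    by_cases hr : p ∣ r
    · rw [if_pos hr, if_pos hr]
      have e1 : (1 - 1 / (p : ℝ) ^ 2) = (1 + 1 / p) * (1 - 1 / p) := by field_simp; ring
      have e2 : 1 + -(p : ℝ) * ((p : ℝ) ^ 2)⁻¹ = 1 - 1 / p := by field_simp; ring
      rw [e1] at hA
      rw [e1, e2, mul_inv, mul_comm, mul_assoc, inv_mul_cancel₀ (right_ne_zero_of_mul hA), mul_one]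
    · rw [if_neg hr, if_neg hr]
      simp
  · have hg : Nat.gcd m p = 1 := ((Nat.Prime.coprime_iff_not_dvd hp).2 hm).symm
    rw [hg, if_neg hm, if_pos (one_dvd _)]
    have e2 : 1 + -((1 : ℕ) : ℝ) * ((p : ℝ) ^ 2)⁻¹ = 1 - 1 / (p : ℝ) ^ 2 := by
      rw [one_div]; push_cast; ring
    rw [e2, mul_inv_cancel₀ hA]

lemma auxH_prod (r m : ℕ) (hm : 1 ≤ m) :
    HasProd (fun p : Nat.Primes => auxH r m p) (∏ p ∈ m.primeFactors, auxH r m p) := by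
  have h := hasProd_prod_of_ne_finset_one (f := fun p : Nat.Primes => auxH r m p)
    (s := m.primeFactors.subtype Nat.Prime) (L := SummationFilter.unconditional _) (by
      intro p hp
      have : ¬ ((p : ℕ) ∣ m) := by
        intro h
        apply hp
        exact Finset.mem_subtype.2 (Nat.mem_primeFactors.2 ⟨p.2, h, by omega⟩)
      simp [auxH, this])
  have e := Finset.prod_subtype_of_mem (s := m.primeFactors) (p := Nat.Prime) (auxH r m)
    (fun x hx => Nat.prime_of_mem_primeFactors hx)
  rw [← e]
  exact h

lemma auxF_tsum (r m : ℕ) (hm : 1 ≤ m) :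
    ∑' d, auxF r m d = 6 / Real.pi ^ 2 *
      ((∏ p ∈ m.primeFactors.filter (fun p => p ∣ r), (1 + 1 / (p : ℝ))⁻¹) *
            (∏ p ∈ m.primeFactors.filter (fun p => ¬ p ∣ r),
              (1 - 1 / (p : ℝ) ^ 2)⁻¹)) := by
  have h1 := EulerProduct.eulerProduct_hasProd (f := auxF r m) (by simp [auxF, auxW])
    (by
      intro a b hab
      unfold auxF
      rw [ArithmeticFunction.isMultiplicative_moebius.map_mul_of_coprime hab, auxW_mul r m hab]
      push_cast
      rw [mul_pow, mul_inv]
      ring) (auxF_summable r m hm) (by simp [auxF])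
  have h2 := h1.mul aux_zeta
  have h3 : (fun p : Nat.Primes => (∑' e, auxF r m ((p : ℕ) ^ e)) *
      (1 - 1 / ((p : ℕ) : ℝ) ^ 2)⁻¹) = fun p : Nat.Primes => auxH r m p := by
    funext p
    exact auxF_local r m p p.2
  rw [h3] at h2
  have h4 := h2.unique (auxH_prod r m hm)
  have h5 : ∏ p ∈ m.primeFactors, auxH r m p =
      (∏ p ∈ m.primeFactors.filter (fun p => p ∣ r), (1 + 1 / (p : ℝ))⁻¹) *
            (∏ p ∈ m.primeFactors.filter (fun p => ¬ p ∣ r),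
              (1 - 1 / (p : ℝ) ^ 2)⁻¹) := by
    rw [← Finset.prod_filter_mul_prod_filter_not m.primeFactors (fun p => p ∣ r)]
    congr 1
    · apply Finset.prod_congr rfl
      intro p hp
      obtain ⟨h6, h7⟩ := Finset.mem_filter.1 hp
      simp [auxH, Nat.dvd_of_mem_primeFactors h6, h7]
    · apply Finset.prod_congr rfl
      intro p hp
      obtain ⟨h6, h7⟩ := Finset.mem_filter.1 hp
      simp [auxH, Nat.dvd_of_mem_primeFactors h6, h7]
  rw [← h5, ← h4]
  have := Real.pi_pos
  field_simp

theorem stmt_17 (r m : ℕ) (hr : 1 ≤ r) (hm : 1 ≤ m) :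
    ∃ C : ℝ, 0 < C ∧ ∀ x : ℝ, 2 ≤ x →
      |(∑ n ∈ (Finset.Icc 1 ⌊x⌋₊).filter (fun n => n % m = r % m),
          (Nat.totient n : ℝ)) -
        (3 / Real.pi ^ 2) *
          ((1 / (m : ℝ)) *
            (∏ p ∈ m.primeFactors.filter (fun p => p ∣ r), (1 + 1 / (p : ℝ))⁻¹) *
            (∏ p ∈ m.primeFactors.filter (fun p => ¬ p ∣ r),
              (1 - 1 / (p : ℝ) ^ 2)⁻¹)) * x ^ 2|
        ≤ C * x * Real.log x := by
  refine ⟨8, by norm_num, fun x hx => ?_⟩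
  have hm0 : (0 : ℝ) < m := by exact_mod_cast hm
  have hx0 : (0 : ℝ) < x := by linarith
  rw [aux_sum]
  set X := ⌊x⌋₊ with hX
  have hX1 : 1 ≤ X := Nat.le_floor (by push_cast; linarith)
  have hXx : (X : ℝ) ≤ x := Nat.floor_le hx0.le
  have hxX : x < X + 1 := Nat.lt_floor_add_one x
  set A := ∑' d, auxF r m d with hA
  have hmain : (3 / Real.pi ^ 2) *
          ((1 / (m : ℝ)) *
            (∏ p ∈ m.primeFactors.filter (fun p => p ∣ r), (1 + 1 / (p : ℝ))⁻¹) *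
            (∏ p ∈ m.primeFactors.filter (fun p => ¬ p ∣ r),
              (1 - 1 / (p : ℝ) ^ 2)⁻¹)) * x ^ 2 = x ^ 2 / (2 * m) * A := by
    rw [hA, auxF_tsum r m hm]
    have := Real.pi_pos
    field_simp
    ring
  rw [hmain]
  have htail : |x ^ 2 / (2 * m) * ∑ d ∈ Finset.Ioc 0 X, auxF r m d - x ^ 2 / (2 * m) * A| ≤ x := by
    rw [← mul_sub, abs_mul, abs_of_pos (by positivity : 0 < x ^ 2 / (2 * (m : ℝ)))]
    have hX0 : (1 : ℝ) ≤ X := by exact_mod_cast hX1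
    calc x ^ 2 / (2 * m) * |∑ d ∈ Finset.Ioc 0 X, auxF r m d - A|
        ≤ x ^ 2 / (2 * m) * (m * (X : ℝ)⁻¹) := by
          gcongr
          exact auxF_tail r m hm X hX1
      _ = x * (x / (2 * X)) := by field_simp
      _ ≤ x * 1 := by
          gcongr
          rw [div_le_one (by positivity)]
          linarith
      _ = x := mul_one x
  have hE : |∑ d ∈ Finset.Ioc 0 X, (ArithmeticFunction.moebius d : ℝ) *
        ∑ e ∈ (Finset.Ioc 0 (X / d)).filter (fun n => (d * n) % m = r % m), (e : ℝ) -
        x ^ 2 / (2 * m) * ∑ d ∈ Finset.Ioc 0 X, auxF r m d| ≤ 2 * x * (1 + Real.log x) := by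
    rw [Finset.mul_sum, ← Finset.sum_sub_distrib]
    have hh : ∑ d ∈ Finset.Ioc 0 X, ((d : ℝ))⁻¹ ≤ 1 + Real.log x := by
      have h := harmonic_floor_le_one_add_log x (by linarith)
      rw [harmonic_eq_sum_Icc] at h
      push_cast at h
      exact h
    calc _ ≤ ∑ d ∈ Finset.Ioc 0 X, |(ArithmeticFunction.moebius d : ℝ) *
        ∑ e ∈ (Finset.Ioc 0 (X / d)).filter (fun n => (d * n) % m = r % m), (e : ℝ) -
        x ^ 2 / (2 * m) * auxF r m d| := Finset.abs_sum_le_sum_abs _ _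
      _ ≤ ∑ d ∈ Finset.Ioc 0 X, 2 * x * ((d : ℝ))⁻¹ := by
          apply Finset.sum_le_sum
          intro d hd
          obtain ⟨hd1, hd2⟩ := Finset.mem_Ioc.1 hd
          have hd0 : (0 : ℝ) < d := by exact_mod_cast hd1
          have hdX : (d : ℝ) ≤ X := by exact_mod_cast hd2
          have hy : 1 ≤ x / d := by
            rw [one_le_div hd0]
            linarith
          have h := aux_inner r m hm d (x / d) hy
          rw [Nat.floor_div_natCast, ← hX] at h
          have hmu : |(ArithmeticFunction.moebius d : ℝ)| ≤ 1 := by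
            exact_mod_cast (ArithmeticFunction.abs_moebius_le_one (n := d))
          have e1 : x ^ 2 / (2 * m) * auxF r m d = (ArithmeticFunction.moebius d : ℝ) *
              ((auxW r m d : ℝ) / (2 * m) * (x / d) ^ 2) := by
            unfold auxF
            field_simp
          rw [e1, ← mul_sub, abs_mul]
          calc _ ≤ 1 * (2 * (x / d)) := by gcongr
            _ = 2 * x * ((d : ℝ))⁻¹ := by rw [div_eq_mul_inv]; ring
      _ = 2 * x * ∑ d ∈ Finset.Ioc 0 X, ((d : ℝ))⁻¹ := by rw [Finset.mul_sum]
      _ ≤ _ := by gcongr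
  have hlog : 1 / 2 ≤ Real.log x := by
    have h1 := Real.log_two_gt_d9
    have h2 := Real.log_le_log (by norm_num) hx
    linarith
  refine (abs_sub_le _ (x ^ 2 / (2 * m) * ∑ d ∈ Finset.Ioc 0 X, auxF r m d) _).trans ?_
  nlinarith
end
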